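/- Let k be a field, N ∈ ℕ, and F := Frac(k[X₁,…,X_N]) the field of fractions of the polynomial ring MvPolynomial (Fin N) k. For a ∈ ℤ^N, let x^a ∈ F denote the Laurent monomial (image of Π_i X_i^{max(a(i),0)}) divided by (image of Π_i X_i^{max(−a(i),0)}). For a subgroup M of ℤ^N, let k(M) denote the subfield of F generated by the image of k together with {x^a | a ∈ M}. Let L' ≤ L be subgroups of ℤ^N with L' of finite index r in L, and let m₁, …, m_r ∈ L be a complete set of coset representatives of L' in L (every element of L is congruent modulo L' to exactly one m_t). Then x^{m₁}, …, x^{m_r} form a basis of k(L) as a vector space over its subfield k(L'); in particular, the field extension degree [k(L) : k(L')] equals the group index [L : L']. -/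

import Mathlib

open MvPolynomial

/-- The Laurent monomial `x^a` in the fraction field of `k[X₁,…,X_N]`. -/
noncomputable def laurent (k : Type*) [Field k] (N : ℕ) (a : Fin N → ℤ) :
    FractionRing (MvPolynomial (Fin N) k) :=
  algebraMap (MvPolynomial (Fin N) k) (FractionRing (MvPolynomial (Fin N) k))
      (∏ i, X i ^ (a i).toNat) /
    algebraMap (MvPolynomial (Fin N) k) (FractionRing (MvPolynomial (Fin N) k))
      (∏ i, X i ^ (-a i).toNat)

/-- For a subgroup `M ≤ ℤ^N`, the subfield `k(M)` of `Frac k[X₁,…,X_N]` generated by the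
image of `k` together with the Laurent monomials `x^a`, `a ∈ M`. -/
noncomputable def latticeField (k : Type*) [Field k] (N : ℕ) (M : AddSubgroup (Fin N → ℤ)) :
    Subfield (FractionRing (MvPolynomial (Fin N) k)) :=
  Subfield.closure
    (Set.range ((algebraMap (MvPolynomial (Fin N) k)
        (FractionRing (MvPolynomial (Fin N) k))).comp (C : k →+* MvPolynomial (Fin N) k)) ∪
      (laurent k N '' (M : Set (Fin N → ℤ))))

theorem laurent_eq_prod_zpow (k : Type*) [Field k] (N : ℕ) (a : Fin N → ℤ) :
    laurent k N a = ∏ i, algebraMap (MvPolynomial (Fin N) k)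
      (FractionRing (MvPolynomial (Fin N) k)) (X i) ^ a i := by
  simp only [laurent, map_prod, map_pow]
  rw [← Finset.prod_div_distrib]
  refine Finset.prod_congr rfl fun i _ => ?_
  rcases le_total 0 (a i) with h | h
  · obtain ⟨n, hn⟩ := Int.eq_ofNat_of_zero_le h
    simp [hn]
  · obtain ⟨n, hn⟩ := Int.eq_ofNat_of_zero_le (neg_nonneg.2 h)
    have h' : a i = -n := by omega
    simp [h']

theorem algebraMap_X_ne_zero (k : Type*) [Field k] (N : ℕ) (i : Fin N) :
    algebraMap (MvPolynomial (Fin N) k) (FractionRing (MvPolynomial (Fin N) k)) (X i) ≠ 0 := by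
  simp [X_ne_zero]

theorem laurent_zero (k : Type*) [Field k] (N : ℕ) : laurent k N 0 = 1 := by
  simp [laurent_eq_prod_zpow]

theorem laurent_add (k : Type*) [Field k] (N : ℕ) (a b : Fin N → ℤ) :
    laurent k N (a + b) = laurent k N a * laurent k N b := by
  simp only [laurent_eq_prod_zpow, ← Finset.prod_mul_distrib, Pi.add_apply]
  exact Finset.prod_congr rfl fun i _ => zpow_add₀ (algebraMap_X_ne_zero k N i) _ _

theorem laurent_of_nonneg (k : Type*) [Field k] (N : ℕ) (a : Fin N → ℤ) (ha : ∀ i, 0 ≤ a i) :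
    laurent k N a = algebraMap (MvPolynomial (Fin N) k) (FractionRing (MvPolynomial (Fin N) k))
      (monomial (Finsupp.equivFunOnFinite.symm fun i => (a i).toNat) 1) := by
  have h (i : Fin N) : (-a i).toNat = 0 := by have := ha i; omega
  simp only [laurent, h, pow_zero, Finset.prod_const_one, map_one, div_one]
  congr 1
  rw [monomial_eq, Finsupp.prod_fintype _ _ (by simp)]
  simp

theorem linearIndependent_laurent (k : Type*) [Field k] (N : ℕ) :
    LinearIndependent k (laurent k N) := by
  rw [linearIndependent_iff']
  intro s g hg a₀ ha₀
  let b : Fin N → ℤ := fun i => ∑ a ∈ s, |a i|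
  have hb (a) (ha : a ∈ s) (i : Fin N) : 0 ≤ (a + b) i := by
    have h₁ : |a i| ≤ b i :=
      Finset.single_le_sum (f := fun a : Fin N → ℤ => |a i|) (fun _ _ => abs_nonneg _) ha
    have h₂ := neg_abs_le (a i)
    rw [Pi.add_apply]
    linarith
  let e : (Fin N → ℤ) → (Fin N →₀ ℕ) :=
    fun a => Finsupp.equivFunOnFinite.symm fun i => ((a + b) i).toNat
  have he (a) (ha : a ∈ s) (h : e a = e a₀) : a = a₀ := by
    ext i
    have h₁ : ((a + b) i).toNat = ((a₀ + b) i).toNat := DFunLike.congr_fun h i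
    have h₂ := hb a ha i
    have h₃ := hb a₀ ha₀ i
    simp only [Pi.add_apply] at h₁ h₂ h₃
    omega
  have hsum : ∑ a ∈ s, monomial (e a) (g a) = 0 := by
    apply IsFractionRing.injective (MvPolynomial (Fin N) k)
      (FractionRing (MvPolynomial (Fin N) k))
    have h := congrArg (· * laurent k N b) hg
    simp only [Finset.sum_mul, zero_mul, smul_mul_assoc, ← laurent_add] at h
    rw [map_sum, map_zero, ← h]
    refine Finset.sum_congr rfl fun a ha => ?_
    rw [laurent_of_nonneg k N _ (hb a ha), ← algebraMap_smul (MvPolynomial (Fin N) k) (g a), Algebra.smul_def,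
      ← map_mul, algebraMap_eq, C_mul_monomial, mul_one]
  have h := congrArg (coeff (e a₀)) hsum
  rw [coeff_sum, Finset.sum_eq_single a₀] at h
  · simpa using h
  · intro a ha hne
    rw [coeff_monomial, if_neg fun h => hne (he a ha h)]
  · exact fun h => (h ha₀).elim

/-- The Laurent monomials with exponents in a subgroup `M` form a multiplicative submonoid. -/
noncomputable def laurentSubmonoid (k : Type*) [Field k] (N : ℕ)
    (M : AddSubgroup (Fin N → ℤ)) : Submonoid (FractionRing (MvPolynomial (Fin N) k)) where
  carrier := laurent k N '' M
  one_mem' := ⟨0, M.zero_mem, laurent_zero k N⟩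
  mul_mem' := by
    rintro _ _ ⟨a, ha, rfl⟩ ⟨b, hb, rfl⟩
    exact ⟨a + b, M.add_mem ha hb, laurent_add k N a b⟩

theorem adjoin_laurent_eq_span (R : Type*) [CommSemiring R] (k : Type*) [Field k] (N : ℕ)
    [Algebra R (FractionRing (MvPolynomial (Fin N) k))] (M : AddSubgroup (Fin N → ℤ)) :
    Subalgebra.toSubmodule (Algebra.adjoin R (laurent k N '' M)) =
      Submodule.span R (laurent k N '' M) := by
  rw [Algebra.adjoin_eq_span]
  exact congrArg (fun S : Submonoid (FractionRing (MvPolynomial (Fin N) k)) =>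
      Submodule.span R (S : Set (FractionRing (MvPolynomial (Fin N) k))))
    (Submonoid.closure_eq (laurentSubmonoid k N M))

theorem exists_div_of_mem_latticeField {k : Type*} [Field k] {N : ℕ}
    {M : AddSubgroup (Fin N → ℤ)} {x : FractionRing (MvPolynomial (Fin N) k)}
    (hx : x ∈ latticeField k N M) :
    ∃ y ∈ Algebra.adjoin k (laurent k N '' M), ∃ z ∈ Algebra.adjoin k (laurent k N '' M),
      z ≠ 0 ∧ x = y / z := by
  obtain ⟨y, hy, z, hz, rfl⟩ := Subfield.mem_closure_iff.1 hx
  have hle : Subring.closure (Set.range ((algebraMap (MvPolynomial (Fin N) k)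
        (FractionRing (MvPolynomial (Fin N) k))).comp (C : k →+* MvPolynomial (Fin N) k)) ∪
      (laurent k N '' (M : Set (Fin N → ℤ)))) ≤
      (Algebra.adjoin k (laurent k N '' M)).toSubring := by
    rw [Subring.closure_le]
    rintro _ (⟨c, rfl⟩ | h)
    · exact (Algebra.adjoin k (laurent k N '' M)).algebraMap_mem c
    · exact Algebra.subset_adjoin h
  by_cases h : z = 0
  · exact ⟨0, zero_mem _, 1, one_mem _, one_ne_zero, by simp [h]⟩
  · exact ⟨y, hle hy, z, hle hz, h, rfl⟩

theorem exists_common_denominator {ι F S : Type*} [Fintype ι] [Field F] [SetLike S F]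
    [SubmonoidClass S F] (A : S) (c : ι → F)
    (hc : ∀ t, ∃ y ∈ A, ∃ z ∈ A, z ≠ 0 ∧ c t = y / z) :
    ∃ d : F, d ≠ 0 ∧ ∀ t, c t * d ∈ A := by
  classical
  choose y hy z hz hz0 hyz using hc
  refine ⟨∏ t, z t, Finset.prod_ne_zero_iff.2 fun t _ => hz0 t, fun t => ?_⟩
  rw [← Finset.mul_prod_erase _ _ (Finset.mem_univ t), ← mul_assoc, hyz t,
    div_mul_cancel₀ _ (hz0 t)]
  exact mul_mem (hy t) (prod_mem fun s _ => hz s)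

theorem eq_zero_of_sum_mul_laurent_eq_zero {k : Type*} [Field k] {N : ℕ} {ι : Type*} [Fintype ι]
    {M : AddSubgroup (Fin N → ℤ)} {m : ι → Fin N → ℤ}
    (hm : ∀ s t, m s - m t ∈ M → s = t) {c : ι → FractionRing (MvPolynomial (Fin N) k)}
    (hc : ∀ t, c t ∈ Algebra.adjoin k (laurent k N '' M))
    (h : ∑ t, c t * laurent k N (m t) = 0) (s : ι) : c s = 0 := by
  have hf (t) : ∃ f ∈ Finsupp.supported k k (M : Set (Fin N → ℤ)),
      Finsupp.linearCombination k (laurent k N) f = c t := by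
    rw [← Finsupp.mem_span_image_iff_linearCombination, ← adjoin_laurent_eq_span]
    exact hc t
  choose f hfM hfc using hf
  have hshift (t) : c t * laurent k N (m t) = Finsupp.linearCombination k (laurent k N)
      (Finsupp.equivMapDomain (Equiv.addRight (m t)) (f t)) := by
    rw [← hfc, Finsupp.linearCombination_equivMapDomain, Finsupp.linearCombination_apply,
      Finsupp.linearCombination_apply, Finsupp.sum_mul]
    refine Finsupp.sum_congr fun a _ => ?_
    simp [laurent_add]
  simp only [hshift, ← map_sum] at h
  have h0 := (linearIndependent_iff.1 (linearIndependent_laurent k N)) _ h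
  have hs : f s = 0 := by
    ext a
    by_cases ha : a ∈ M
    · have h1 := DFunLike.congr_fun h0 (a + m s)
      rw [Finsupp.finsetSum_apply, Finset.sum_eq_single s] at h1
      · simpa [Finsupp.equivMapDomain_apply] using h1
      · intro t _ hts
        rw [Finsupp.equivMapDomain_apply]
        refine (Finsupp.mem_supported' k _).1 (hfM t) _ fun hmem => hts ?_
        refine (hm s t ?_).symm
        have hsub := M.sub_mem hmem ha
        simpa [add_sub_assoc, ← sub_eq_add_neg] using hsub
      · simp
    · exact (Finsupp.mem_supported' k _).1 (hfM s) a ha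
  rw [← hfc, hs, map_zero]

theorem inv_mem_of_le_span_finite {K F : Type*} [Field K] [Field F] [Algebra K F]
    {A : Subalgebra K F} {s : Set F} (hs : s.Finite)
    (hle : Subalgebra.toSubmodule A ≤ Submodule.span K s) {x : F} (hx : x ∈ A) : x⁻¹ ∈ A := by
  have := FiniteDimensional.span_of_finite K hs
  have hfin : FiniteDimensional K A := Submodule.finiteDimensional_of_le hle
  exact A.inv_mem_of_algebraic (x := ⟨x, hx⟩)
    ((Algebra.IsAlgebraic.isAlgebraic (R := K) (⟨x, hx⟩ : A)).algebraMap)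

theorem laurent_mem_latticeField {k : Type*} [Field k] {N : ℕ} {M : AddSubgroup (Fin N → ℤ)}
    {a : Fin N → ℤ} (ha : a ∈ M) : laurent k N a ∈ latticeField k N M :=
  Subfield.subset_closure (Or.inr ⟨a, ha, rfl⟩)

theorem mem_span_laurent_of_mem_latticeField {k : Type*} [Field k] {N : ℕ} {ι : Type*} [Finite ι]
    {L L' : AddSubgroup (Fin N → ℤ)} {m : ι → Fin N → ℤ}
    (hreps : ∀ x ∈ L, ∃ t, x - m t ∈ L')
    {y : FractionRing (MvPolynomial (Fin N) k)} (hy : y ∈ latticeField k N L) :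
    y ∈ Submodule.span (latticeField k N L') (Set.range fun t => laurent k N (m t)) := by
  set A := Algebra.adjoin (latticeField k N L') (laurent k N '' L) with hA
  have hle : Subalgebra.toSubmodule A ≤
      Submodule.span (latticeField k N L') (Set.range fun t => laurent k N (m t)) := by
    rw [hA, adjoin_laurent_eq_span, Submodule.span_le]
    rintro _ ⟨a, ha, rfl⟩
    obtain ⟨t, ht⟩ := hreps a ha
    have h : laurent k N a =
        (⟨_, laurent_mem_latticeField ht⟩ : latticeField k N L') • laurent k N (m t) := by
      rw [Subfield.smul_def, smul_eq_mul, ← laurent_add, sub_add_cancel]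
    rw [h]
    exact Submodule.smul_mem _ _ (Submodule.subset_span ⟨t, rfl⟩)
  have hinv (x) (hx : x ∈ A) : x⁻¹ ∈ A :=
    inv_mem_of_le_span_finite (Set.finite_range _) hle hx
  let K : Subfield (FractionRing (MvPolynomial (Fin N) k)) :=
    { A.toSubring with inv_mem' := hinv }
  have hK : latticeField k N L ≤ K := by
    refine Subfield.closure_le.2 ?_
    rintro _ (⟨c, rfl⟩ | h)
    · exact A.algebraMap_mem ⟨_, Subfield.subset_closure (Or.inl ⟨c, rfl⟩)⟩
    · exact Algebra.subset_adjoin h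
  exact hle (hK hy)

/-- Let `L' ≤ L` be subgroups of `ℤ^N` with `L'` of finite index `r` in `L`,
and let `m 0, …, m (r-1)` be a complete set of coset representatives of `L'` in `L`. Then the
Laurent monomials `x^{m t}` form a basis of `k(L)` as a vector space over `k(L')`: they are
linearly independent over `k(L')` and span `k(L)` over `k(L')` (in particular
`[k(L) : k(L')] = [L : L']`). -/
theorem stmt_17 (k : Type*) [Field k] (N : ℕ) (r : ℕ) (hr : r ≠ 0)
    (L L' : AddSubgroup (Fin N → ℤ)) (hLL : L' ≤ L)
    (m : Fin r → (Fin N → ℤ)) (hmL : ∀ t, m t ∈ L)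
    (hreps : ∀ x ∈ L, ∃! t : Fin r, x - m t ∈ L') :
    (∀ c : Fin r → FractionRing (MvPolynomial (Fin N) k),
        (∀ t, c t ∈ latticeField k N L') →
        ∑ t, c t * laurent k N (m t) = 0 → ∀ t, c t = 0) ∧
      (∀ y ∈ latticeField k N L,
        ∃ c : Fin r → FractionRing (MvPolynomial (Fin N) k),
          (∀ t, c t ∈ latticeField k N L') ∧ y = ∑ t, c t * laurent k N (m t)) := by
  have hm (s t) (h : m s - m t ∈ L') : s = t :=
    (hreps (m s) (hmL s)).unique (by simp) h
  constructor
  · intro c hc h s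
    obtain ⟨d, hd, hcd⟩ := exists_common_denominator
      (Algebra.adjoin k (laurent k N '' L')) c fun t => exists_div_of_mem_latticeField (hc t)
    have h' : ∑ t, c t * d * laurent k N (m t) = 0 := by
      rw [← zero_mul d, ← h, Finset.sum_mul]
      exact Finset.sum_congr rfl fun t _ => by ring
    exact (mul_eq_zero.1 (eq_zero_of_sum_mul_laurent_eq_zero hm hcd h' s)).resolve_right hd
  · intro y hy
    obtain ⟨c, hc⟩ := (Submodule.mem_span_range_iff_exists_fun _).1
      (mem_span_laurent_of_mem_latticeField (fun x hx => (hreps x hx).exists) hy)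
    exact ⟨fun t => c t, fun t => (c t).2, hc.symm⟩
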